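/- Let K be a field of characteristic 0 and δ a nonzero derivation on K with field of constants F. If f ∈ K[t;δ] of degree m ≥ 2 is an irreducible A-polynomial (equivalently, f is irreducible and dim_F Nuc_r(S_f) = m²), then f is not bounded. -/

import Mathlib

open scoped TensorProduct

/-! ## A framework for differential polynomial rings `K[t;δ]` and Petit algebras `S_f`. -/

/-- A derivation on a field `K`: an additive map satisfying the Leibniz rule. -/
structure Der (K : Type) [Field K] where
  toFun : K → K
  map_add' : ∀ a b : K, toFun (a + b) = toFun a + toFun b
  leibniz' : ∀ a b : K, toFun (a * b) = a * toFun b + toFun a * b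

/-- `F` (given as a subfield of `K` via `algebraMap F K`) is precisely the field of
constants `Const(δ) = {a ∈ K | δ(a) = 0}` of the derivation `δ`. -/
def Der.HasConstants {K : Type} [Field K] (δ : Der K) (F : Type) [Field F]
    [Algebra F K] : Prop :=
  ∀ a : K, δ.toFun a = 0 ↔ ∃ c : F, algebraMap F K c = a

/-- The map `V_p(b) = b^p + δ^{p-1}(b)`. -/
def Der.Vp {K : Type} [Field K] (δ : Der K) (p : ℕ) (b : K) : K :=
  b ^ p + δ.toFun^[p - 1] b

/-- The `e`-fold iterate `V_{p^e}` of `V_p`. -/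
def Der.VpIter {K : Type} [Field K] (δ : Der K) (p e : ℕ) : K → K :=
  (δ.Vp p)^[e]

/-- A realization of the differential polynomial ring `R = K[t;δ]`: a ring `R`
together with an embedding `i : K → R` and an element `t` satisfying the
twist relation `t·a = a·t + δ(a)`, such that every element of `R` is *uniquely*
a left `K`-linear combination of the powers `t^n` (witnessed by the coefficient
function `coeff`), and such that `R` admits a right division algorithm. -/
structure DiffPolyRing (K : Type) [Field K] (δ : Der K) (R : Type) [Ring R] where
  i : K →+* R
  t : R
  coeff : R → (ℕ →₀ K)
  t_mul : ∀ a : K, t * i a = i a * t + i (δ.toFun a)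
  repr' : ∀ x : R, x = (coeff x).sum fun n a => i a * t ^ n
  coeff_unique : ∀ (x : R) (c : ℕ →₀ K), x = (c.sum fun n a => i a * t ^ n) → c = coeff x
  rightDiv : ∀ f x : R, f ≠ 0 → ∃! r : R,
    (∃ q : R, x = q * f + r) ∧ (coeff r).support.max < (coeff f).support.max

namespace DiffPolyRing

variable {K : Type} [Field K] {δ : Der K} {R : Type} [Ring R]

/-- The degree of a differential polynomial, with `deg 0 = ⊥`. -/
def deg (D : DiffPolyRing K δ R) (x : R) : WithBot ℕ := (D.coeff x).support.max

lemma coeff_zero (D : DiffPolyRing K δ R) : D.coeff 0 = 0 :=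
  (D.coeff_unique 0 0 (by simp)).symm

lemma deg_zero (D : DiffPolyRing K δ R) : D.deg 0 = ⊥ := by
  simp [deg, D.coeff_zero]

lemma coeff_add (D : DiffPolyRing K δ R) (x y : R) :
    D.coeff (x + y) = D.coeff x + D.coeff y := by
  refine (D.coeff_unique _ _ ?_).symm
  rw [Finsupp.sum_add_index' (by simp) (by intro n a b; rw [map_add, add_mul])]
  conv_lhs => rw [D.repr' x, D.repr' y]

lemma coeff_neg (D : DiffPolyRing K δ R) (x : R) : D.coeff (-x) = -D.coeff x := by
  have h := D.coeff_add (-x) x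
  rw [neg_add_cancel, D.coeff_zero] at h
  exact eq_neg_of_add_eq_zero_left h.symm

lemma deg_neg (D : DiffPolyRing K δ R) (x : R) : D.deg (-x) = D.deg x := by
  simp [deg, D.coeff_neg]

lemma deg_add_lt (D : DiffPolyRing K δ R) {x y : R} {n : WithBot ℕ}
    (hx : D.deg x < n) (hy : D.deg y < n) : D.deg (x + y) < n := by
  have hsub : (D.coeff (x + y)).support ⊆ (D.coeff x).support ∪ (D.coeff y).support := by
    rw [D.coeff_add]; exact Finsupp.support_add
  calc D.deg (x + y) ≤ ((D.coeff x).support ∪ (D.coeff y).support).max :=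
        Finset.max_mono hsub
    _ = max (D.deg x) (D.deg y) := Finset.max_union
    _ < n := max_lt hx hy

lemma coeff_smul (D : DiffPolyRing K δ R) (c : K) (x : R) :
    D.coeff (D.i c * x) = c • D.coeff x := by
  refine (D.coeff_unique _ _ ?_).symm
  rw [Finsupp.sum_smul_index (by simp)]
  conv_lhs => rw [D.repr' x, Finsupp.mul_sum]
  exact Finsupp.sum_congr fun n _ => by rw [← mul_assoc, ← map_mul]

lemma deg_i_mul_lt (D : DiffPolyRing K δ R) (c : K) {x : R} {n : WithBot ℕ}
    (hx : D.deg x < n) : D.deg (D.i c * x) < n := by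
  have hsub : (D.coeff (D.i c * x)).support ⊆ (D.coeff x).support := by
    rw [D.coeff_smul]; exact Finsupp.support_smul
  exact lt_of_le_of_lt (Finset.max_mono hsub) hx

/-- The additive subgroup of `R` consisting of the differential polynomials of
degree `< m`; this is the underlying set of the Petit algebra `S_f` for `deg f = m`. -/
def res (D : DiffPolyRing K δ R) (m : ℕ) : AddSubgroup R where
  carrier := {x | D.deg x < (m : WithBot ℕ)}
  add_mem' hx hy := D.deg_add_lt hx hy
  zero_mem' := by
    show D.deg 0 < (m : WithBot ℕ)
    rw [D.deg_zero]
    exact bot_lt_iff_ne_bot.2 (by simp)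
  neg_mem' {x} hx := by
    show D.deg (-x) < (m : WithBot ℕ)
    rw [D.deg_neg]; exact hx

/-- The underlying set `{g ∈ K[t;δ] | deg g < m}` of the Petit algebra `S_f`
(for `f` of degree `m`), viewed as a subset of `R = K[t;δ]`. -/
def SfSet (D : DiffPolyRing K δ R) (m : ℕ) : Set R := {x | D.deg x < (m : WithBot ℕ)}

/-- The underlying `F`-vector space of the Petit algebra `S_f`, for `f` of degree `m`. -/
abbrev Rlt (D : DiffPolyRing K δ R) (m : ℕ) : Type := ↥(D.res m)

instance instSMul {F : Type} [Field F] [Algebra F K] (D : DiffPolyRing K δ R) (m : ℕ) :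
    SMul F (D.Rlt m) :=
  ⟨fun c x => ⟨D.i (algebraMap F K c) * (x : R), D.deg_i_mul_lt _ x.2⟩⟩

lemma smul_coe {F : Type} [Field F] [Algebra F K] (D : DiffPolyRing K δ R) (m : ℕ)
    (c : F) (x : D.Rlt m) : ((c • x : D.Rlt m) : R) = D.i (algebraMap F K c) * (x : R) := rfl

/-- The `F`-vector space structure of the Petit algebra (where `F ⊆ K` is the field
of constants): `c • x = i(c)·x`. -/
instance instModule {F : Type} [Field F] [Algebra F K] (D : DiffPolyRing K δ R) (m : ℕ) :
    Module F (D.Rlt m) where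
  one_smul x := Subtype.ext <| by rw [smul_coe]; simp
  mul_smul a b x := Subtype.ext <| by rw [smul_coe, smul_coe, smul_coe]; simp [mul_assoc]
  smul_zero a := Subtype.ext <| by rw [smul_coe]; simp
  smul_add a x y := Subtype.ext <| by
    rw [smul_coe]
    push_cast
    rw [smul_coe, smul_coe, mul_add]
  add_smul a b x := Subtype.ext <| by
    push_cast
    rw [smul_coe, smul_coe, smul_coe]
    simp [add_mul]
  zero_smul x := Subtype.ext <| by rw [smul_coe]; simp

open Classical in
/-- The remainder `mod_r f` of right division by `f`. -/
noncomputable def modr (D : DiffPolyRing K δ R) (f x : R) : R :=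
  if h : ∃! r : R, (∃ q : R, x = q * f + r) ∧
      (D.coeff r).support.max < (D.coeff f).support.max then h.choose else 0

/-- The multiplication of the Petit algebra `S_f`: `g ∘ h = g·h mod_r f`. -/
noncomputable def pmul (D : DiffPolyRing K δ R) (f x y : R) : R := D.modr f (x * y)

/-- The left nucleus of the Petit algebra `S_f`, as a subset of `R`. -/
def nucl (D : DiffPolyRing K δ R) (f : R) (m : ℕ) : Set R :=
  {x ∈ D.SfSet m | ∀ y ∈ D.SfSet m, ∀ z ∈ D.SfSet m,
    D.pmul f (D.pmul f x y) z = D.pmul f x (D.pmul f y z)}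

/-- The middle nucleus of the Petit algebra `S_f`, as a subset of `R`. -/
def nucm (D : DiffPolyRing K δ R) (f : R) (m : ℕ) : Set R :=
  {x ∈ D.SfSet m | ∀ y ∈ D.SfSet m, ∀ z ∈ D.SfSet m,
    D.pmul f (D.pmul f y x) z = D.pmul f y (D.pmul f x z)}

/-- The right nucleus of the Petit algebra `S_f`, as a subset of `R`. -/
def nucr (D : DiffPolyRing K δ R) (f : R) (m : ℕ) : Set R :=
  {x ∈ D.SfSet m | ∀ y ∈ D.SfSet m, ∀ z ∈ D.SfSet m,
    D.pmul f (D.pmul f y z) x = D.pmul f y (D.pmul f z x)}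

/-- The nucleus of the Petit algebra `S_f`, as a subset of `R`. -/
def nuc (D : DiffPolyRing K δ R) (f : R) (m : ℕ) : Set R :=
  D.nucl f m ∩ D.nucm f m ∩ D.nucr f m

/-- `f` is irreducible in `K[t;δ]`: it is not a unit and admits no factorization
into two factors of strictly smaller degree. -/
def Irred (D : DiffPolyRing K δ R) (f : R) : Prop :=
  ¬IsUnit f ∧ ¬∃ g h : R, f = g * h ∧ D.deg g < D.deg f ∧ D.deg h < D.deg f

/-- The Petit algebra `S_f` is a division algebra: it is nonzero, and all left and
right multiplications by nonzero elements are bijective. -/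
def IsDivisionPetit (D : DiffPolyRing K δ R) (f : R) (m : ℕ) : Prop :=
  (∃ x ∈ D.SfSet m, x ≠ 0) ∧ ∀ a ∈ D.SfSet m, a ≠ 0 →
    Set.BijOn (fun x => D.pmul f a x) (D.SfSet m) (D.SfSet m) ∧
    Set.BijOn (fun x => D.pmul f x a) (D.SfSet m) (D.SfSet m)

/-- The unital `F`-algebra `B` realizes the right nucleus of the Petit algebra `S_f`:
there is a bijection `B ≃ Nuc_r(S_f)` preserving addition, multiplication and the
`F`-algebra structure. -/
def RightNucPresents (F : Type) [Field F] [Algebra F K] (D : DiffPolyRing K δ R)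
    (f : R) (m : ℕ) (B : Type) [Ring B] [Algebra F B] : Prop :=
  ∃ φ : B ≃ (D.nucr f m),
    (∀ x y : B, ((φ (x + y) : R)) = (φ x : R) + (φ y : R)) ∧
    (∀ x y : B, ((φ (x * y) : R)) = D.pmul f (φ x : R) (φ y : R)) ∧
    (∀ c : F, ((φ (algebraMap F B c) : R)) = D.i (algebraMap F K c))

/-- A subset `S` of an `F`-vector space has dimension `d`: it contains `d` linearly
independent vectors whose span contains `S`. -/
def SetDim (F : Type) [Field F] {M : Type} [AddCommGroup M] [Module F M]
    (S : Set M) (d : ℕ) : Prop :=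
  ∃ s : Finset M, ↑s ⊆ S ∧ s.card = d ∧
    LinearIndependent F (fun x : (s : Set M) => (x : M)) ∧
    S ⊆ (Submodule.span F (s : Set M) : Set M)

/-- `f ∈ K[t;δ]` of degree `m` is an `A`-polynomial (over the field of constants `F`),
via Amitsur's characterization: the right nucleus of `S_f` has dimension `m²` over `F`. -/
def IsAPoly (F : Type) [Field F] [Algebra F K] (D : DiffPolyRing K δ R)
    (f : R) (m : ℕ) : Prop :=
  SetDim F {x : D.Rlt m | (x : R) ∈ D.nucr f m} (m ^ 2)

/-- `f ∈ R = K[t;δ]` is bounded: there is `f* ≠ 0` such that `Rf* = f*R` is the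
largest two-sided ideal of `R` contained in `Rf`. -/
def IsBounded (D : DiffPolyRing K δ R) (f : R) : Prop :=
  ∃ fs : R, fs ≠ 0 ∧
    {x : R | ∃ r, x = r * fs} = {x : R | ∃ r, x = fs * r} ∧
    (∀ x : R, (∃ r, x = r * fs) → ∃ r, x = r * f) ∧
    ∀ J : Set R, (0 : R) ∈ J → (∀ a ∈ J, ∀ b ∈ J, a + b ∈ J) →
      (∀ r : R, ∀ a ∈ J, r * a ∈ J ∧ a * r ∈ J) →
      (∀ x ∈ J, ∃ r, x = r * f) → ∀ x ∈ J, ∃ r, x = r * fs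

/-- `S_f` is a free right module of rank `n` over its right nucleus. -/
def FreeRankOverNucr (D : DiffPolyRing K δ R) (f : R) (m n : ℕ) : Prop :=
  ∃ b : Fin n → R, (∀ j, b j ∈ D.SfSet m) ∧
    ∀ x ∈ D.SfSet m, ∃! c : Fin n → (D.nucr f m),
      x = ∑ j, D.pmul f (b j) ((c j : R))

/-- The Petit algebra `S_f` is unital with unit `1 ∈ K[t;δ]`. -/
def PetitUnital (D : DiffPolyRing K δ R) (f : R) (m : ℕ) : Prop :=
  (1 : R) ∈ D.SfSet m ∧ ∀ x ∈ D.SfSet m, D.pmul f 1 x = x ∧ D.pmul f x 1 = x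

end DiffPolyRing

namespace DiffPolyRing

variable {K : Type} [Field K] {δ : Der K} {R : Type} [Ring R]

lemma coeff_monomial (D : DiffPolyRing K δ R) (a : K) (n : ℕ) :
    D.coeff (D.i a * D.t ^ n) = Finsupp.single n a :=
  (D.coeff_unique _ _ (by simp)).symm

lemma mem_res_iff (D : DiffPolyRing K δ R) {m : ℕ} {x : R} :
    x ∈ D.res m ↔ ∀ j, m ≤ j → D.coeff x j = 0 := by
  change (D.coeff x).support.max < (m : WithBot ℕ) ↔ _
  refine (Finset.sup_lt_iff (WithBot.bot_lt_coe m)).trans (forall_congr' fun j => ?_)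
  rw [Finsupp.mem_support_iff, not_imp_comm]
  simp

lemma res_mono (D : DiffPolyRing K δ R) {m n : ℕ} (h : m ≤ n) : D.res m ≤ D.res n :=
  fun _ hx => D.mem_res_iff.2 fun j hj => D.mem_res_iff.1 hx j (h.trans hj)

lemma monomial_mem_res (D : DiffPolyRing K δ R) (a : K) {n m : ℕ} (h : n < m) :
    D.i a * D.t ^ n ∈ D.res m :=
  D.mem_res_iff.2 fun j hj => by
    rw [D.coeff_monomial, Finsupp.single_eq_of_ne (by omega)]

/-- An additive subgroup containing all monomials of degree `< m` contains `D.res m`. -/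
lemma res_le_of_monomial_mem (D : DiffPolyRing K δ R) {m : ℕ} {S : AddSubgroup R}
    (h : ∀ (a : K) (n : ℕ), n < m → D.i a * D.t ^ n ∈ S) : D.res m ≤ S := by
  intro x hx
  rw [D.repr' x]
  refine S.sum_mem fun n hn => h _ _ ?_
  by_contra hlt
  exact Finsupp.mem_support_iff.1 hn (D.mem_res_iff.1 hx n (not_lt.1 hlt))

lemma t_mul_mem_res (D : DiffPolyRing K δ R) {m : ℕ} {x : R} (hx : x ∈ D.res m) :
    D.t * x ∈ D.res (m + 1) := by
  refine D.res_le_of_monomial_mem (S := (D.res (m + 1)).comap (AddMonoidHom.mulLeft D.t))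
    (fun a n hn => ?_) hx
  change D.t * (D.i a * D.t ^ n) ∈ D.res (m + 1)
  rw [← mul_assoc, D.t_mul, add_mul, mul_assoc, ← pow_succ']
  exact add_mem (D.monomial_mem_res _ (by omega)) (D.monomial_mem_res _ (by omega))

/-- `t ^ (k + 1) * a = a * t ^ (k + 1) + (k + 1) * δ a * t ^ k` up to terms of degree `< k`. -/
lemma t_pow_succ_mul (D : DiffPolyRing K δ R) (a : K) (k : ℕ) :
    D.t ^ (k + 1) * D.i a - D.i a * D.t ^ (k + 1)
      - D.i ((k + 1 : K) * δ.toFun a) * D.t ^ k ∈ D.res k := by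
  induction k with
  | zero => simp [D.t_mul]
  | succ k ih =>
    set c : K := (k + 1 : K) * δ.toFun a with hc
    have key := add_mem (D.t_mul_mem_res ih)
      (D.monomial_mem_res (δ.toFun c) (Nat.lt_succ_self k))
    convert key using 1
    have h1 : D.t * (D.i a * D.t ^ (k + 1))
        = D.i a * D.t ^ (k + 1 + 1) + D.i (δ.toFun a) * D.t ^ (k + 1) := by
      rw [← mul_assoc, D.t_mul, add_mul, mul_assoc, ← pow_succ']
    have h2 : D.t * (D.i c * D.t ^ k)
        = D.i c * D.t ^ (k + 1) + D.i (δ.toFun c) * D.t ^ k := by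
      rw [← mul_assoc, D.t_mul, add_mul, mul_assoc, ← pow_succ']
    have h3 : ((k + 1 : ℕ) + 1 : K) * δ.toFun a = c + δ.toFun a := by
      rw [hc]; push_cast; ring
    rw [h3, mul_sub, mul_sub, h1, h2, ← mul_assoc, ← pow_succ', map_add, add_mul]
    abel

lemma commutator_mem_res (D : DiffPolyRing K δ R) (a : K) {k : ℕ} {x : R}
    (hx : x ∈ D.res (k + 1)) : x * D.i a - D.i a * x ∈ D.res k := by
  refine D.res_le_of_monomial_mem (S := (D.res k).comap
    (AddMonoidHom.mulRight (D.i a) - AddMonoidHom.mulLeft (D.i a))) (fun b n hn => ?_) hx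
  change D.i b * D.t ^ n * D.i a - D.i a * (D.i b * D.t ^ n) ∈ D.res k
  have hcomm : D.i a * (D.i b * D.t ^ n) = D.i b * (D.i a * D.t ^ n) := by
    rw [← mul_assoc, ← mul_assoc, ← map_mul, ← map_mul, mul_comm]
  rw [hcomm, mul_assoc, ← mul_sub]
  refine D.deg_i_mul_lt b ?_
  cases n with
  | zero => simp [D.deg_zero]
  | succ n =>
    exact (sub_add_cancel (D.t ^ (n + 1) * D.i a - D.i a * D.t ^ (n + 1)) _) ▸
      add_mem (D.res_mono (by omega) (D.t_pow_succ_mul a n))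
        (D.monomial_mem_res ((n + 1 : K) * δ.toFun a) (by omega))

lemma coeff_commutator (D : DiffPolyRing K δ R) (a : K) {k : ℕ} {x : R}
    (hx : x ∈ D.res (k + 2)) :
    D.coeff (x * D.i a - D.i a * x) k = D.coeff x (k + 1) * ((k + 1 : K) * δ.toFun a) := by
  set b := D.coeff x (k + 1) with hb
  set y := x - D.i b * D.t ^ (k + 1) with hy
  set z := D.t ^ (k + 1) * D.i a - D.i a * D.t ^ (k + 1)
      - D.i ((k + 1 : K) * δ.toFun a) * D.t ^ k with hz
  have hymem : y ∈ D.res (k + 1) := D.mem_res_iff.2 fun j hj => by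
    rw [hy, sub_eq_add_neg, D.coeff_add, D.coeff_neg, D.coeff_monomial]
    rcases hj.eq_or_lt with rfl | hj
    · simp [hb]
    · simp [D.mem_res_iff.1 hx j hj, Finsupp.single_eq_of_ne hj.ne']
  have hcomm : D.i a * (D.i b * D.t ^ (k + 1)) = D.i b * (D.i a * D.t ^ (k + 1)) := by
    rw [← mul_assoc, ← mul_assoc, ← map_mul, ← map_mul, mul_comm]
  have hsplit : x * D.i a - D.i a * x = D.i (b * ((k + 1 : K) * δ.toFun a)) * D.t ^ k
      + (D.i b * z + (y * D.i a - D.i a * y)) := by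
    rw [hy, hz, mul_sub (D.i a), hcomm, map_mul]
    noncomm_ring
  have hlow : D.i b * z + (y * D.i a - D.i a * y) ∈ D.res k :=
    add_mem (D.deg_i_mul_lt b (D.t_pow_succ_mul a k)) (D.commutator_mem_res a hymem)
  rw [hsplit, D.coeff_add, D.coeff_monomial, Finsupp.add_apply,
    D.mem_res_iff.1 hlow k le_rfl]
  simp

/-- A left multiple of `f` of degree smaller than `f` vanishes. -/
lemma mul_eq_zero_of_deg_lt (D : DiffPolyRing K δ R) {f r : R}
    (h : D.deg (r * f) < D.deg f) : r * f = 0 := by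
  have hf : f ≠ 0 := by
    rintro rfl
    simp at h
  have h0 : D.deg 0 < D.deg f := by
    rw [D.deg_zero]
    exact bot_le.trans_lt h
  exact (D.rightDiv f (r * f) hf).unique ⟨⟨0, by simp⟩, h⟩ ⟨⟨r, by simp⟩, h0⟩

lemma deg_nonpos_of_right_mul_mem [CharZero K] (D : DiffPolyRing K δ R)
    (hδ : ∃ a : K, δ.toFun a ≠ 0) {g : R} (hg : ∀ s, ∃ r, g * s = r * g) : D.deg g ≤ 0 := by
  obtain ⟨a, ha⟩ := hδ
  by_contra hpos
  obtain ⟨n, hn⟩ := WithBot.ne_bot_iff_exists.1 (ne_bot_of_gt (not_le.1 hpos))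
  obtain ⟨k, rfl⟩ : ∃ k, n = k + 1 := Nat.exists_eq_succ_of_ne_zero (by
    rintro rfl
    exact hpos hn.symm.le)
  have hmem : g ∈ D.res (k + 2) := by
    change D.deg g < _
    rw [← hn]
    exact WithBot.coe_lt_coe.2 (Nat.lt_succ_self _)
  have hlead : D.coeff g (k + 1) ≠ 0 :=
    Finsupp.mem_support_iff.1 (Finset.mem_of_max hn.symm)
  obtain ⟨r, hr⟩ := hg (D.i a)
  have hmul : g * D.i a - D.i a * g = (r - D.i a) * g := by rw [hr, sub_mul]
  have hzero : g * D.i a - D.i a * g = 0 := by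
    rw [hmul]
    refine D.mul_eq_zero_of_deg_lt ?_
    rw [← hmul, ← hn]
    exact D.commutator_mem_res a hmem
  have hcoeff := D.coeff_commutator a hmem
  rw [hzero, D.coeff_zero, Finsupp.zero_apply] at hcoeff
  exact mul_ne_zero hlead (mul_ne_zero (Nat.cast_add_one_ne_zero k) ha) hcoeff.symm

end DiffPolyRing

/-- In characteristic zero with `δ ≠ 0`: an irreducible `A`-polynomial
`f ∈ K[t;δ]` of degree `m ≥ 2` (i.e. irreducible with `dim_F Nuc_r(S_f) = m²`) is not
bounded. -/
theorem statement_17 (F K : Type) [Field F] [Field K] [CharZero K] [Algebra F K]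
    (δ : Der K) (hδ : ∃ a : K, δ.toFun a ≠ 0) (hconst : δ.HasConstants F)
    (R : Type) [Ring R] (D : DiffPolyRing K δ R) (f : R) (m : ℕ) (hm : 2 ≤ m)
    (hdeg : D.deg f = (m : WithBot ℕ)) (hirr : D.Irred f) (hA : D.IsAPoly F f m) :
    ¬D.IsBounded f := by
  rintro ⟨g, hg0, hRg, hgf, -⟩
  have hg : D.deg g ≤ 0 := D.deg_nonpos_of_right_mul_mem hδ fun s =>
    (hRg.symm ▸ (⟨s, rfl⟩ : g * s ∈ {x : R | ∃ r, x = g * r}) :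
      g * s ∈ {x : R | ∃ r, x = r * g})
  obtain ⟨r, rfl⟩ := hgf g ⟨1, (one_mul g).symm⟩
  refine hg0 (D.mul_eq_zero_of_deg_lt (hg.trans_lt ?_))
  rw [hdeg]
  exact_mod_cast (by omega : 0 < m)
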